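/- arXiv:1701.00646 — 5 statements merged into one kernel-verified Lean document; each statement's English description precedes it below -/
import Mathlib

section
/- Let S be a finite nonempty set, d ≥ 1, T : S → S → ℝ, γ ∈ ℝ, ρ : S → Fin d, and x : Fin d → ℝ. Define scalar iterates v_0(s) = 0 and v_{t+1}(s) = x(ρ(s)) + γ Σ_{s'∈S} T(s,s')·v_t(s'), and decumulative-vector iterates 𝐯_0(s) = 0 ∈ ℝ^d and 𝐯_{t+1}(s) = (e_{ρ(s)})^↓ + γ Σ_{s'∈S} T(s,s')·𝐯_t(s'), where (e_i)^↓ ∈ ℝ^d is the vector whose k-th component is 1 if k ≤ i and 0 otherwise. Define c ∈ ℝ^d by c_0 = x_0 and c_k = x_k − x_{k−1} for k ≥ 1. Then for every t ∈ ℕ and every s ∈ S, v_t(s) = Σ_k c_k · (𝐯_t(s))_k. -/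
/-- Consecutive differences of `x`, summed against the decumulative of the `i`-th basis vector,
telescope to `x i`. -/
theorem sum_differences_mul_indicator_le {d : ℕ} (x c : Fin d → ℝ)
    (hc : ∀ k : Fin d, c k =
      if h : (k : ℕ) = 0 then x k
      else x k - x ⟨(k : ℕ) - 1, Nat.lt_of_le_of_lt (Nat.sub_le _ _) k.isLt⟩)
    (i : Fin d) : ∑ k : Fin d, c k * (if k ≤ i then (1 : ℝ) else 0) = x i := by
  obtain ⟨n, hn⟩ := i
  induction n with
  | zero =>
    have key (k : Fin d) : k ≤ ⟨0, hn⟩ ↔ k = ⟨0, hn⟩ := by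
      simp only [Fin.le_def, Fin.ext_iff]
      omega
    simp [key, hc]
  | succ n ih =>
    have key (k : Fin d) : (if k ≤ ⟨n + 1, hn⟩ then (1 : ℝ) else 0) =
        (if k ≤ ⟨n, by omega⟩ then 1 else 0) + (if k = ⟨n + 1, hn⟩ then 1 else 0) := by
      simp only [Fin.le_def, Fin.ext_iff]
      split_ifs <;> first | omega | norm_num
    simp only [key, mul_add, Finset.sum_add_distrib]
    rw [ih (by omega)]
    simp [hc]

/-- Lemma 1 (second equality) of the paper: the scalar value-iteration sequence
`v_t` equals the inner product of the consecutive reward differences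
`c = (x 0, x 1 - x 0, …, x (d-1) - x (d-2))` with the decumulative-vector
value-iteration sequence `𝐯_t`, whose vector reward at state `s` is the
decumulative `(e_{ρ s})^↓`, with `k`-th component `1` if `k ≤ ρ s` and `0`
otherwise. -/
theorem scalar_eq_inner_decumulative (S : Type) [Fintype S] [Nonempty S]
    (d : ℕ) (hd : 1 ≤ d)
    (T : S → S → ℝ) (γ : ℝ) (ρ : S → Fin d) (x : Fin d → ℝ)
    (v : ℕ → S → ℝ) (vv : ℕ → S → Fin d → ℝ)
    (c : Fin d → ℝ)
    (hc : ∀ k : Fin d, c k =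
      if h : (k : ℕ) = 0 then x k
      else x k - x ⟨(k : ℕ) - 1, Nat.lt_of_le_of_lt (Nat.sub_le _ _) k.isLt⟩)
    (hv0 : ∀ s : S, v 0 s = 0)
    (hv : ∀ (t : ℕ) (s : S), v (t + 1) s = x (ρ s) + γ * ∑ s' : S, T s s' * v t s')
    (hvv0 : ∀ (s : S) (k : Fin d), vv 0 s k = 0)
    (hvv : ∀ (t : ℕ) (s : S) (k : Fin d),
      vv (t + 1) s k =
        (if k ≤ ρ s then (1 : ℝ) else 0) + γ * ∑ s' : S, T s s' * vv t s' k) :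
    ∀ (t : ℕ) (s : S), v t s = ∑ k : Fin d, c k * vv t s k := by
  intro t
  induction t with
  | zero => intro s; simp [hv0, hvv0]
  | succ t ih =>
    intro s
    simp only [hv, hvv, ih, mul_add, Finset.sum_add_distrib]
    rw [sum_differences_mul_indicator_le x c hc]
    congr 1
    simp only [Finset.mul_sum]
    rw [Finset.sum_comm]
    refine Finset.sum_congr rfl fun k _ => Finset.sum_congr rfl fun s' _ => ?_
    ring
end

section
/- Let S be a finite nonempty set, d ≥ 1, T : S → S → ℝ, γ ∈ ℝ, and ρ : S → Fin d. Define counting-vector iterates v̄_0(s) = 0 ∈ ℝ^d, v̄_{t+1}(s) = e_{ρ(s)} + γ Σ_{s'∈S} T(s,s')·v̄_t(s'), and decumulative-vector iterates 𝐯_0(s) = 0 ∈ ℝ^d, 𝐯_{t+1}(s) = (e_{ρ(s)})^↓ + γ Σ_{s'∈S} T(s,s')·𝐯_t(s'). Then for every t ∈ ℕ, s ∈ S, and k ∈ Fin d, (𝐯_t(s))_k = Σ_{j ≥ k} (v̄_t(s))_j; that is, 𝐯_t(s) is the decumulative of v̄_t(s). -/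
/-- The decumulative of a vector `u ∈ ℝ^d`: `decum u k = ∑_{j ≥ k} u j`. -/
noncomputable def decum {d : ℕ} (u : Fin d → ℝ) (k : Fin d) : ℝ :=
  ∑ j ∈ Finset.univ.filter (fun j => k ≤ j), u j

/-- Section 4.1 of the paper: the decumulative-vector value-iteration sequence
`𝐯_t` (computed from the decumulative rewards `(e_{ρ s})^↓`) is exactly the
decumulative of the counting value-iteration sequence `v̄_t` (computed from the
canonical-vector rewards `e_{ρ s}`). -/
theorem decumulative_of_counting (S : Type) [Fintype S] [Nonempty S]
    (d : ℕ) (hd : 1 ≤ d)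
    (T : S → S → ℝ) (γ : ℝ) (ρ : S → Fin d)
    (vbar : ℕ → S → Fin d → ℝ) (vv : ℕ → S → Fin d → ℝ)
    (hvbar0 : ∀ (s : S) (i : Fin d), vbar 0 s i = 0)
    (hvbar : ∀ (t : ℕ) (s : S) (i : Fin d),
      vbar (t + 1) s i =
        (if i = ρ s then (1 : ℝ) else 0) + γ * ∑ s' : S, T s s' * vbar t s' i)
    (hvv0 : ∀ (s : S) (k : Fin d), vv 0 s k = 0)
    (hvv : ∀ (t : ℕ) (s : S) (k : Fin d),
      vv (t + 1) s k =
        (if k ≤ ρ s then (1 : ℝ) else 0) + γ * ∑ s' : S, T s s' * vv t s' k) :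
    ∀ (t : ℕ) (s : S) (k : Fin d), vv t s k = decum (vbar t s) k := by
  intro t
  induction t with
  | zero => simp [decum, hvbar0, hvv0]
  | succ t ih =>
    intro s k
    simp only [decum] at ih
    simp only [decum, hvv, hvbar, ih, Finset.sum_add_distrib, ← Finset.mul_sum]
    congr 1
    · simp [Finset.sum_ite_eq']
    · rw [Finset.sum_comm]
      simp only [Finset.mul_sum]
end

section
/- Let S be a finite nonempty set, d ≥ 1, T : S → S → ℝ, γ ∈ ℝ, ρ : S → Fin d, x ∈ ℝ^d, and let H be an invertible d × d real matrix. Define r ∈ ℝ^d by r_i = Σ_j x_j · H_{j i}, and c ∈ ℝ^d by c_0 = r_0 and c_k = r_k − r_{k−1} for k ≥ 1. Define scalar iterates v_0(s) = 0, v_{t+1}(s) = x(ρ(s)) + γ Σ_{s'∈S} T(s,s')·v_t(s'), and vector iterates 𝐯_0(s) = 0 ∈ ℝ^d, 𝐯_{t+1}(s) = (H⁻¹ e_{ρ(s)})^↓ + γ Σ_{s'∈S} T(s,s')·𝐯_t(s'), where u^↓_k = Σ_{j ≥ k} u_j and e_i is the i-th canonical basis vector (so H⁻¹ e_i is the i-th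 column of H⁻¹). Then for every t ∈ ℕ and s ∈ S, v_t(s) = Σ_k c_k · (𝐯_t(s))_k. -/
/-- Partial sums of the consecutive differences of `r` recover `r`. -/
theorem sum_filter_le_of_consecutive_sub {d : ℕ} {r c : Fin d → ℝ}
    (hc : ∀ k : Fin d, c k =
      if _ : (k : ℕ) = 0 then r k
      else r k - r ⟨(k : ℕ) - 1, Nat.lt_of_le_of_lt (Nat.sub_le _ _) k.isLt⟩)
    (j : Fin d) : ∑ k ∈ Finset.univ.filter (fun k => k ≤ j), c k = r j := by
  obtain ⟨n, hn⟩ := j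
  induction n with
  | zero =>
    have hs : Finset.univ.filter (fun k : Fin d => k ≤ ⟨0, hn⟩) = {⟨0, hn⟩} := by
      ext k
      simp [Fin.le_def, Fin.ext_iff]
    rw [hs, Finset.sum_singleton, hc]
    simp
  | succ n ih =>
    have hn' : n < d := by omega
    have hs : Finset.univ.filter (fun k : Fin d => k ≤ ⟨n + 1, hn⟩) =
        insert ⟨n + 1, hn⟩ (Finset.univ.filter (fun k : Fin d => k ≤ ⟨n, hn'⟩)) := by
      ext k
      simp only [Finset.mem_filter, Finset.mem_univ, true_and, Finset.mem_insert,
        Fin.le_def, Fin.ext_iff]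
      omega
    rw [hs, Finset.sum_insert (by simp [Fin.le_def]), ih hn', hc]
    simp

/-- Summation by parts: pairing `c` with a decumulative pairs the partial sums of `c` with the
original vector. -/
theorem sum_mul_decum {d : ℕ} (c u : Fin d → ℝ) :
    ∑ k, c k * decum u k =
      ∑ j, (∑ k ∈ Finset.univ.filter (fun k => k ≤ j), c k) * u j := by
  simp only [decum, Finset.mul_sum, Finset.sum_mul]
  exact Finset.sum_comm' (by simp)

/-- Lemma 2 of the paper ('ordered histories' transformation): the scalar
value-iteration sequence `v_t` equals the inner product of the consecutive
differences `c` of `r i = x · (i-th column of H)` with the vector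
value-iteration sequence `𝐯_t` whose reward at state `s` is the decumulative of
the `ρ s`-th column of `H⁻¹` (i.e. of `H⁻¹ e_{ρ s}`). -/
theorem scalar_eq_inner_ordered_histories (S : Type) [Fintype S] [Nonempty S]
    (d : ℕ) (hd : 1 ≤ d)
    (T : S → S → ℝ) (γ : ℝ) (ρ : S → Fin d) (x : Fin d → ℝ)
    (H : Matrix (Fin d) (Fin d) ℝ) (hH : IsUnit H)
    (r c : Fin d → ℝ)
    (hr : ∀ i : Fin d, r i = ∑ j : Fin d, x j * H j i)
    (hc : ∀ k : Fin d, c k =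
      if h : (k : ℕ) = 0 then r k
      else r k - r ⟨(k : ℕ) - 1, Nat.lt_of_le_of_lt (Nat.sub_le _ _) k.isLt⟩)
    (v : ℕ → S → ℝ) (vv : ℕ → S → Fin d → ℝ)
    (hv0 : ∀ s : S, v 0 s = 0)
    (hv : ∀ (t : ℕ) (s : S), v (t + 1) s = x (ρ s) + γ * ∑ s' : S, T s s' * v t s')
    (hvv0 : ∀ (s : S) (k : Fin d), vv 0 s k = 0)
    (hvv : ∀ (t : ℕ) (s : S) (k : Fin d),
      vv (t + 1) s k =
        decum (fun j => H⁻¹ j (ρ s)) k + γ * ∑ s' : S, T s s' * vv t s' k) :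
    ∀ (t : ℕ) (s : S), v t s = ∑ k : Fin d, c k * vv t s k := by
  have hx : Matrix.vecMul r H⁻¹ = x := by
    have hr' : r = Matrix.vecMul x H := funext hr
    rw [hr', Matrix.vecMul_vecMul,
      Matrix.mul_nonsing_inv _ ((Matrix.isUnit_iff_isUnit_det H).mp hH), Matrix.vecMul_one]
  have hreward (i : Fin d) : ∑ k, c k * decum (fun j => H⁻¹ j i) k = x i := by
    simp only [sum_mul_decum, sum_filter_le_of_consecutive_sub hc]
    exact congrFun hx i
  intro t
  induction t with
  | zero => simp [hv0, hvv0]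
  | succ t ih =>
    intro s
    simp only [hv, hvv, mul_add, Finset.sum_add_distrib, hreward, ih, Finset.mul_sum]
    rw [Finset.sum_comm]
    congr 1
    refine Finset.sum_congr rfl fun k _ => Finset.sum_congr rfl fun s' _ => ?_
    ring
end

section
/- Let d ≥ 1, let V be a finite nonempty subset of ℝ^d, define I ∈ ℝ^d by I_i = max_{w ∈ V} w_i, and let Δ = {x ∈ ℝ^d : x_i ≥ 0 for all i and Σ_i x_i ≤ 1}. For v ∈ V set Cheb(v) = max_i (I_i − v_i) and Reg(v) = sup_{x ∈ Δ} max_{w ∈ V} Σ_i x_i·(w_i − v_i). Then for every v* ∈ V: v* minimizes Cheb over V if and only if v* minimizes Reg over V. -/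
/-- The maximal regret of a point of `V` over the simplex is attained, and it equals the
Chebyshev distance to the ideal point of `V`. -/
theorem isGreatest_regret_chebyshev {ι : Type*} [Fintype ι]
    (hι : (Finset.univ : Finset ι).Nonempty) (V : Finset (ι → ℝ)) (hV : V.Nonempty)
    {v : ι → ℝ} (hv : v ∈ V) :
    IsGreatest ((fun x : ι → ℝ => V.sup' hV (fun w => ∑ i, x i * (w i - v i))) ''
        {x | (∀ i, 0 ≤ x i) ∧ ∑ i, x i ≤ 1})
      (Finset.univ.sup' hι (fun i => V.sup' hV (fun w => w i) - v i)) := by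
  classical
  set C := Finset.univ.sup' hι (fun i => V.sup' hV (fun w => w i) - v i) with hC
  have hle : ∀ w ∈ V, ∀ i, w i - v i ≤ C := fun w hw i =>
    (sub_le_sub_right (Finset.le_sup' (fun w : ι → ℝ => w i) hw) _).trans
      (Finset.le_sup' (fun i => V.sup' hV (fun w => w i) - v i) (Finset.mem_univ i))
  have hC0 : 0 ≤ C := by simpa using hle v hv hι.choose
  have hub : ∀ x : ι → ℝ, (∀ i, 0 ≤ x i) → ∑ i, x i ≤ 1 →
      V.sup' hV (fun w => ∑ i, x i * (w i - v i)) ≤ C := by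
    intro x hx hsum
    refine Finset.sup'_le _ _ fun w hw => ?_
    calc ∑ i, x i * (w i - v i) ≤ ∑ i, x i * C :=
          Finset.sum_le_sum fun i _ => mul_le_mul_of_nonneg_left (hle w hw i) (hx i)
      _ = (∑ i, x i) * C := (Finset.sum_mul _ _ _).symm
      _ ≤ C := mul_le_of_le_one_left hC0 hsum
  refine ⟨?_, by rintro _ ⟨x, ⟨hx, hsum⟩, rfl⟩; exact hub x hx hsum⟩
  obtain ⟨i, -, hi⟩ := Finset.exists_mem_eq_sup' hι (fun i => V.sup' hV (fun w => w i) - v i)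
  obtain ⟨w, hw, hwi⟩ := Finset.exists_mem_eq_sup' hV (fun w : ι → ℝ => w i)
  have hx : ∀ j, 0 ≤ (Pi.single i 1 : ι → ℝ) j := fun j =>
    (Pi.single_nonneg.2 zero_le_one : (0 : ι → ℝ) ≤ Pi.single i 1) j
  have hsum : ∑ j, (Pi.single i 1 : ι → ℝ) j ≤ 1 := by simp
  refine ⟨Pi.single i 1, ⟨hx, hsum⟩, le_antisymm (hub _ hx hsum) ?_⟩
  calc C = ∑ j, (Pi.single i 1 : ι → ℝ) j * (w j - v j) := by
        rw [hC, hi, hwi]; simp [Pi.single_apply]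
    _ ≤ _ := Finset.le_sup' (fun w : ι → ℝ => ∑ j, (Pi.single i 1 : ι → ℝ) j * (w j - v j)) hw

/-- Lemma 3 of the paper: a point `v* ∈ V` minimizes the Chebyshev distance to
the ideal point `I` of `V` if and only if it minimizes the maximal regret over
the simplex `Δ` of admissible nonnegative reward-difference vectors. -/
theorem chebyshev_optimal_iff_minimax_regret_optimal (d : ℕ) (hd : 1 ≤ d)
    (V : Finset (Fin d → ℝ)) (hV : V.Nonempty)
    (I : Fin d → ℝ) (hI : ∀ i : Fin d, I i = V.sup' hV (fun w => w i))
    (Δ : Set (Fin d → ℝ))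
    (hΔ : Δ = {x : Fin d → ℝ | (∀ i : Fin d, 0 ≤ x i) ∧ ∑ i : Fin d, x i ≤ 1})
    (Cheb Reg : (Fin d → ℝ) → ℝ)
    (hCheb : ∀ v : Fin d → ℝ, Cheb v =
      Finset.univ.sup' (⟨⟨0, hd⟩, Finset.mem_univ _⟩ :
        (Finset.univ : Finset (Fin d)).Nonempty) (fun i => I i - v i))
    (hReg : ∀ v : Fin d → ℝ, Reg v =
      sSup ((fun x : Fin d → ℝ =>
        V.sup' hV (fun w => ∑ i : Fin d, x i * (w i - v i))) '' Δ))
    (vstar : Fin d → ℝ) (hvstar : vstar ∈ V) :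
    (∀ v ∈ V, Cheb vstar ≤ Cheb v) ↔ (∀ v ∈ V, Reg vstar ≤ Reg v) := by
  have hreg : ∀ v ∈ V, Reg v = Cheb v := by
    intro v hv
    rw [hReg, hCheb, hΔ]
    simp only [hI]
    exact (isGreatest_regret_chebyshev _ V hV hv).csSup_eq
  refine forall₂_congr fun v hv => ?_
  rw [hreg v hv, hreg vstar hvstar]
end

section
/- Let S be a finite nonempty set, d ≥ 1, γ ∈ ℝ with γ ≥ 0, and let x ∈ ℝ^d be monotone nondecreasing in the index. Let (T, ρ) and (T', ρ') be two pairs with T, T' : S → S → ℝ, T(s,s') ≥ 0, T'(s,s') ≥ 0, Σ_{s'} T(s,s') = 1 and Σ_{s'} T'(s,s') = 1 for all s, and ρ, ρ' : S → Fin d. Define for each pair the scalar iterates v_0 = 0, v_{t+1}(s) = x(ρ(s)) + γ Σ_{s'} T(s,s')·v_t(s'), and the decumulative-vector iterates 𝐯_0 = 0, 𝐯_{t+1}(s) = (e_{ρ(s)})^↓ + γ Σ_{s'} T(s,s')·𝐯_t(s') (and analogously v'_t, 𝐯'_t for (T', ρ')). If for some t ∈ ℕ and s ∈ S one has (𝐯_t(s))_k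 ≥ (𝐯'_t(s))_k for every k ∈ Fin d, then v_t(s) ≥ v'_t(s). -/
/-- Coefficients expressing the scalar value in terms of the decumulative vector: the first
value, followed by the successive increments. -/
def decumulativeWeight {n : ℕ} (x : Fin (n + 1) → ℝ) : Fin (n + 1) → ℝ :=
  Fin.cases (x 0) fun k => x k.succ - x k.castSucc

lemma decumulativeWeight_nonneg {n : ℕ} {x : Fin (n + 1) → ℝ} (hx : Monotone x)
    {k : Fin (n + 1)} (hk : k ≠ 0) : 0 ≤ decumulativeWeight x k := by
  obtain ⟨j, rfl⟩ := Fin.exists_succ_eq.2 hk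
  exact sub_nonneg.2 (hx (Fin.castSucc_le_succ j))

/-- Summation by parts for a single decumulated basis vector. -/
lemma sum_decumulativeWeight_mul_indicator {n : ℕ} (x : Fin (n + 1) → ℝ) (i : Fin (n + 1)) :
    ∑ k, decumulativeWeight x k * (if k ≤ i then (1 : ℝ) else 0) = x i := by
  induction i using Fin.induction with
  | zero => simp [decumulativeWeight]
  | succ i ih =>
    have h (k : Fin (n + 1)) : (if k ≤ i.succ then (1 : ℝ) else 0) =
        (if k ≤ i.castSucc then 1 else 0) + if k = i.succ then 1 else 0 := by
      simp only [Fin.le_def, Fin.ext_iff, Fin.val_succ, Fin.val_castSucc]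
      split_ifs <;> first | omega | norm_num
    simp only [h, mul_add, Finset.sum_add_distrib, ih]
    simp [decumulativeWeight]

/-- The scalar value iterates are a fixed linear image of the decumulative iterates. -/
lemma scalar_iterate_eq_sum_decumulative {S : Type*} [Fintype S] {n : ℕ} {γ : ℝ}
    {x : Fin (n + 1) → ℝ} {T : S → S → ℝ} {ρ : S → Fin (n + 1)}
    {v : ℕ → S → ℝ} {vv : ℕ → S → Fin (n + 1) → ℝ}
    (hv0 : ∀ s, v 0 s = 0)
    (hv : ∀ t s, v (t + 1) s = x (ρ s) + γ * ∑ s', T s s' * v t s')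
    (hvv0 : ∀ s k, vv 0 s k = 0)
    (hvv : ∀ t s k, vv (t + 1) s k =
      (if k ≤ ρ s then (1 : ℝ) else 0) + γ * ∑ s', T s s' * vv t s' k)
    (t : ℕ) (s : S) : v t s = ∑ k, decumulativeWeight x k * vv t s k := by
  induction t generalizing s with
  | zero => simp [hv0, hvv0]
  | succ t ih =>
    simp only [hv, hvv, mul_add, Finset.sum_add_distrib,
      sum_decumulativeWeight_mul_indicator, ih, Finset.mul_sum]
    rw [Finset.sum_comm]
    congr! 3
    ring

/-- The first decumulative component counts all discounted rewards, whatever the policy. -/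
lemma decumulative_iterate_zero {S : Type*} [Fintype S] {n : ℕ} {γ : ℝ}
    {T : S → S → ℝ} (hT1 : ∀ s, ∑ s', T s s' = 1) {ρ : S → Fin (n + 1)}
    {vv : ℕ → S → Fin (n + 1) → ℝ}
    (hvv0 : ∀ s k, vv 0 s k = 0)
    (hvv : ∀ t s k, vv (t + 1) s k =
      (if k ≤ ρ s then (1 : ℝ) else 0) + γ * ∑ s', T s s' * vv t s' k)
    (t : ℕ) (s : S) : vv t s 0 = ∑ i ∈ Finset.range t, γ ^ i := by
  induction t generalizing s with
  | zero => simp [hvv0]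
  | succ t ih =>
    rw [hvv, geom_sum_succ]
    simp only [ih, ← Finset.sum_mul, hT1]
    simp [add_comm]

/-- End of Section 4.1 of the paper (ordered rewards case): for two stationary
policies encoded by probability kernels `T, T'` and reward-index maps `ρ, ρ'`,
with nondecreasing reward values `x` and `γ ≥ 0`, if the decumulative vector
value-iteration sequence of the first Pareto-dominates (componentwise
dominates) that of the second at time `t` and state `s`, then so do the scalar
values. -/
theorem pareto_decumulative_implies_scalar (S : Type) [Fintype S] [Nonempty S]
    (d : ℕ) (hd : 1 ≤ d)
    (γ : ℝ) (hγ : 0 ≤ γ)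
    (x : Fin d → ℝ) (hmono : ∀ j j' : Fin d, j ≤ j' → x j ≤ x j')
    (T T' : S → S → ℝ)
    (hT : ∀ s s' : S, 0 ≤ T s s') (hT' : ∀ s s' : S, 0 ≤ T' s s')
    (hT1 : ∀ s : S, ∑ s' : S, T s s' = 1) (hT'1 : ∀ s : S, ∑ s' : S, T' s s' = 1)
    (ρ ρ' : S → Fin d)
    (v v' : ℕ → S → ℝ) (vv vv' : ℕ → S → Fin d → ℝ)
    (hv0 : ∀ s : S, v 0 s = 0)
    (hv : ∀ (t : ℕ) (s : S), v (t + 1) s = x (ρ s) + γ * ∑ s' : S, T s s' * v t s')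
    (hv'0 : ∀ s : S, v' 0 s = 0)
    (hv' : ∀ (t : ℕ) (s : S),
      v' (t + 1) s = x (ρ' s) + γ * ∑ s' : S, T' s s' * v' t s')
    (hvv0 : ∀ (s : S) (k : Fin d), vv 0 s k = 0)
    (hvv : ∀ (t : ℕ) (s : S) (k : Fin d),
      vv (t + 1) s k =
        (if k ≤ ρ s then (1 : ℝ) else 0) + γ * ∑ s' : S, T s s' * vv t s' k)
    (hvv'0 : ∀ (s : S) (k : Fin d), vv' 0 s k = 0)
    (hvv' : ∀ (t : ℕ) (s : S) (k : Fin d),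
      vv' (t + 1) s k =
        (if k ≤ ρ' s then (1 : ℝ) else 0) + γ * ∑ s' : S, T' s s' * vv' t s' k)
    (t : ℕ) (s : S)
    (hdom : ∀ k : Fin d, vv t s k ≥ vv' t s k) :
    v t s ≥ v' t s := by
  obtain ⟨n, rfl⟩ := Nat.exists_eq_add_of_le' hd
  rw [scalar_iterate_eq_sum_decumulative hv0 hv hvv0 hvv,
    scalar_iterate_eq_sum_decumulative hv'0 hv' hvv'0 hvv']
  refine Finset.sum_le_sum fun k _ => ?_
  by_cases hk : k = 0
  · rw [hk, decumulative_iterate_zero hT1 hvv0 hvv, decumulative_iterate_zero hT'1 hvv'0 hvv']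
  · exact mul_le_mul_of_nonneg_left (hdom k)
      (decumulativeWeight_nonneg (fun j j' h => hmono j j' h) hk)
end
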